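/- arXiv:1509.04546 — 6 statements merged into one kernel-verified Lean document; each statement's English description precedes it below -/
import Mathlib

section
/- For any two mesh functions U, V ∈ Z_h^0 and any positive integer m, the discretized nonlinear term is orthogonal to V: h Σ_{i=1}^{M−1} [ (U_i)^m (V_{x̂})_i + ((U^m V)_{x̂})_i ] V_i = 0, where (V_{x̂})_i = (V_{i+1} − V_{i−1})/(2h) and ((U^m V)_{x̂})_i = ((U_{i+1})^m V_{i+1} − (U_{i−1})^m V_{i−1})/(2h). -/
theorem telescope_Icc (G : ℤ → ℝ) (n : ℕ) :
    ∑ i ∈ Finset.Icc (1 : ℤ) (n : ℤ), (G i - G (i - 1)) = G n - G 0 := by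
  induction n with
  | zero => simp
  | succ k ih =>
    have e : Finset.Icc (1 : ℤ) ((k + 1 : ℕ) : ℤ)
        = insert ((k : ℤ) + 1) (Finset.Icc (1 : ℤ) (k : ℤ)) := by
      ext x
      simp only [Finset.mem_Icc, Finset.mem_insert]
      omega
    rw [e, Finset.sum_insert (by simp), ih]
    push_cast
    rw [add_sub_cancel_right]
    ring

/-- The specially discretized nonlinear term is orthogonal to `V`:
`h ∑_{i=1}^{M-1} [ (U_i)^m (V_x̂)_i + ((U^m V)_x̂)_i ] V_i = 0`
for mesh functions `U, V` vanishing near the boundary. -/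
theorem stmt_10 (M : ℤ) (hM : 4 ≤ M) (h : ℝ) (hh : 0 < h) (m : ℕ) (hm : 0 < m)
    (U V : ℤ → ℝ)
    (hU : ∀ i : ℤ, (i ≤ 1 ∨ M - 1 ≤ i) → U i = 0)
    (hV : ∀ i : ℤ, (i ≤ 1 ∨ M - 1 ≤ i) → V i = 0) :
    h * ∑ i ∈ Finset.Icc (1 : ℤ) (M - 1),
        ((U i) ^ m * ((V (i + 1) - V (i - 1)) / (2 * h))
          + ((U (i + 1)) ^ m * V (i + 1) - (U (i - 1)) ^ m * V (i - 1)) / (2 * h)) * V i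
      = 0 := by
  obtain ⟨n, hn⟩ := Int.eq_ofNat_of_zero_le (show 0 ≤ M - 1 by omega)
  have key := telescope_Icc
    (fun i => ((U i) ^ m + (U (i + 1)) ^ m) * V i * V (i + 1) / (2 * h)) n
  rw [← hn] at key
  have h0 : V 0 = 0 := hV 0 (by omega)
  have h1 : V (M - 1) = 0 := hV (M - 1) (by omega)
  simp only [h0, h1, mul_zero, zero_mul, zero_div, sub_zero, sub_add_cancel] at key
  rw [mul_eq_zero]
  right
  rw [← key]
  refine Finset.sum_congr rfl fun i _ => ?_
  ring
end

section
/- (Discrete energy conservation of the three-level scheme, single step.) Let m be a positive integer, a, b, c, ν real constants, α, λ > 0, and τ > 0. Let V, U, W ∈ Z_h^0 be mesh functions (playing the roles of U^{n−1}, U^n, U^{n+1}) satisfying, for all 2 ≤ i ≤ M−2, the difference equation (W_i − V_i)/(2τ) + a (P_{x̂})_i + (b/(m+2)) [ (U_i)^m (P_{x̂})_i + ((U^m P)_{x̂})_i ] + c (P_{x x̄ x̂})_i − α ((W − V)_{x x̄})_i/(2τ) + λ ((W − V)_{x x x̄ x̄})_i/(2τ) − ν (P_{x x x̄ x̄ x̂})_i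 = 0, where P = (W + V)/2 and ((U^m P)_{x̂})_i = ((U_{i+1})^m P_{i+1} − (U_{i−1})^m P_{i−1})/(2h). Then the discrete energy is transferred exactly: ‖W‖² + α‖W_x‖² + λ‖W_{x x̄}‖² = ‖V‖² + α‖V_x‖² + λ‖V_{x x̄}‖². -/
theorem tele_aux (F : ℤ → ℝ) (n : ℕ) :
    ∑ i ∈ Finset.Icc (1 : ℤ) (n : ℤ), (F (i + 1) - F i) = F (n + 1) - F 1 := by
  induction n with
  | zero => simp
  | succ k ih =>
    have e : Finset.Icc (1 : ℤ) ((k + 1 : ℕ) : ℤ)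
        = insert ((k : ℤ) + 1) (Finset.Icc (1 : ℤ) (k : ℤ)) := by
      ext x
      simp only [Finset.mem_Icc, Finset.mem_insert]
      push_cast
      omega
    rw [e, Finset.sum_insert (by simp), ih]
    push_cast
    ring

/-- Single-step discrete energy conservation of the three-level linearly implicit scheme:
if `V, U, W ∈ Z_h^0` (playing the roles of `U^{n-1}, U^n, U^{n+1}`) satisfy the scheme with
`P = (W + V)/2`, then `‖W‖² + α‖W_x‖² + λ‖W_{x x̄}‖² = ‖V‖² + α‖V_x‖² + λ‖V_{x x̄}‖²`. -/
theorem stmt_13 (M : ℤ) (hM : 4 ≤ M) (h : ℝ) (hh : 0 < h)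
    (m : ℕ) (hm : 0 < m) (a b c ν α lam τ : ℝ) (hα : 0 < α) (hlam : 0 < lam) (hτ : 0 < τ)
    (V U W P : ℤ → ℝ)
    (hV : ∀ i : ℤ, (i ≤ 1 ∨ M - 1 ≤ i) → V i = 0)
    (hUz : ∀ i : ℤ, (i ≤ 1 ∨ M - 1 ≤ i) → U i = 0)
    (hW : ∀ i : ℤ, (i ≤ 1 ∨ M - 1 ≤ i) → W i = 0)
    (hP : ∀ i : ℤ, P i = (W i + V i) / 2)
    (scheme : ∀ i : ℤ, 2 ≤ i → i ≤ M - 2 →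
      (W i - V i) / (2 * τ)
        + a * ((P (i + 1) - P (i - 1)) / (2 * h))
        + (b / (m + 2)) * ((U i) ^ m * ((P (i + 1) - P (i - 1)) / (2 * h))
            + ((U (i + 1)) ^ m * P (i + 1) - (U (i - 1)) ^ m * P (i - 1)) / (2 * h))
        + c * ((P (i + 2) - 2 * P (i + 1) + 2 * P (i - 1) - P (i - 2)) / (2 * h ^ 3))
        - α * (((W (i + 1) - V (i + 1)) - 2 * (W i - V i) + (W (i - 1) - V (i - 1))) / h ^ 2)
            / (2 * τ)
        + lam * (((W (i + 2) - V (i + 2)) - 4 * (W (i + 1) - V (i + 1)) + 6 * (W i - V i)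
            - 4 * (W (i - 1) - V (i - 1)) + (W (i - 2) - V (i - 2))) / h ^ 4) / (2 * τ)
        - ν * ((P (i + 3) - 4 * P (i + 2) + 5 * P (i + 1) - 5 * P (i - 1) + 4 * P (i - 2)
            - P (i - 3)) / (2 * h ^ 5))
        = 0) :
    (h * ∑ i ∈ Finset.Icc (1 : ℤ) (M - 1), (W i) ^ 2)
      + α * (h * ∑ i ∈ Finset.Icc (1 : ℤ) (M - 1), ((W (i + 1) - W i) / h) ^ 2)
      + lam * (h * ∑ i ∈ Finset.Icc (1 : ℤ) (M - 1),
          ((W (i + 1) - 2 * W i + W (i - 1)) / h ^ 2) ^ 2)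
    = (h * ∑ i ∈ Finset.Icc (1 : ℤ) (M - 1), (V i) ^ 2)
      + α * (h * ∑ i ∈ Finset.Icc (1 : ℤ) (M - 1), ((V (i + 1) - V i) / h) ^ 2)
      + lam * (h * ∑ i ∈ Finset.Icc (1 : ℤ) (M - 1),
          ((V (i + 1) - 2 * V i + V (i - 1)) / h ^ 2) ^ 2) := by
  obtain ⟨n, hn⟩ : ∃ n : ℕ, M - 1 = (n : ℤ) := ⟨(M - 1).toNat, by omega⟩
  have hPz : ∀ i : ℤ, (i ≤ 1 ∨ M - 1 ≤ i) → P i = 0 := by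
    intro i hi
    rw [hP, hV i hi, hW i hi]; simp
  have hS : ∀ i ∈ Finset.Icc (1 : ℤ) (M - 1), P i * ((W i - V i) / (2 * τ)
        + a * ((P (i + 1) - P (i - 1)) / (2 * h))
        + (b / (m + 2)) * ((U i) ^ m * ((P (i + 1) - P (i - 1)) / (2 * h))
            + ((U (i + 1)) ^ m * P (i + 1) - (U (i - 1)) ^ m * P (i - 1)) / (2 * h))
        + c * ((P (i + 2) - 2 * P (i + 1) + 2 * P (i - 1) - P (i - 2)) / (2 * h ^ 3))
        - α * (((W (i + 1) - V (i + 1)) - 2 * (W i - V i) + (W (i - 1) - V (i - 1))) / h ^ 2)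
            / (2 * τ)
        + lam * (((W (i + 2) - V (i + 2)) - 4 * (W (i + 1) - V (i + 1)) + 6 * (W i - V i)
            - 4 * (W (i - 1) - V (i - 1)) + (W (i - 2) - V (i - 2))) / h ^ 4) / (2 * τ)
        - ν * ((P (i + 3) - 4 * P (i + 2) + 5 * P (i + 1) - 5 * P (i - 1) + 4 * P (i - 2)
            - P (i - 3)) / (2 * h ^ 5))) = 0 := by
    intro i hi
    rw [Finset.mem_Icc] at hi
    by_cases h1 : i ≤ 1 ∨ M - 1 ≤ i
    · rw [hPz i h1, zero_mul]
    · rw [scheme i (by omega) (by omega), mul_zero]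
  -- the total flux
  let F : ℤ → ℝ := fun i =>
    2 * α / h ^ 2 * (P i * ((W i - V i) - (W (i - 1) - V (i - 1))))
    - 2 * lam / h ^ 4 *
      (P (i - 1) * ((W (i + 1) - V (i + 1)) - 2 * (W i - V i) + (W (i - 1) - V (i - 1)))
       - P i * ((W i - V i) - 2 * (W (i - 1) - V (i - 1)) + (W (i - 2) - V (i - 2))))
    - 2 * τ * a / h * (P (i - 1) * P i)
    - 2 * τ * (b / (m + 2)) / h * (P (i - 1) * P i * (U (i - 1) ^ m + U i ^ m))
    - 2 * τ * c / h ^ 3 * (P (i - 1) * P (i + 1) + P (i - 2) * P i - 2 * (P (i - 1) * P i))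
    + 2 * τ * ν / h ^ 5 * (P (i - 1) * P (i + 2) + P (i - 2) * P (i + 1) + P (i - 3) * P i
        - 4 * (P (i - 1) * P (i + 1) + P (i - 2) * P i) + 5 * (P (i - 1) * P i))
  have hF1 : F 1 = 0 := by
    simp only [F]
    rw [hPz 1 (by omega), hPz (1 - 1) (by omega), hPz (1 - 2) (by omega)]
    ring
  have hFM : F (M - 1 + 1) = 0 := by
    simp only [F]
    rw [hPz (M - 1 + 1) (by omega), hPz (M - 1 + 1 - 1) (by omega),
      hPz (M - 1 + 1 + 1) (by omega)]
    ring
  have hT : ∑ i ∈ Finset.Icc (1 : ℤ) (M - 1), (F (i + 1) - F i) = 0 := by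
    have := tele_aux F n
    rw [← hn, hF1, hFM] at this
    simpa using this
  have key : ∀ i ∈ Finset.Icc (1 : ℤ) (M - 1),
      ((W i) ^ 2 + α * ((W (i + 1) - W i) / h) ^ 2
        + lam * ((W (i + 1) - 2 * W i + W (i - 1)) / h ^ 2) ^ 2)
      - ((V i) ^ 2 + α * ((V (i + 1) - V i) / h) ^ 2
        + lam * ((V (i + 1) - 2 * V i + V (i - 1)) / h ^ 2) ^ 2) = F (i + 1) - F i := by
    intro i hi
    have h0 := hS i hi
    have e1 : i + 1 - 1 = i := by ring
    have e2 : i + 1 - 2 = i - 1 := by ring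
    have e3 : i + 1 - 3 = i - 2 := by ring
    have e4 : i + 1 + 1 = i + 2 := by ring
    have e5 : i + 1 + 2 = i + 3 := by ring
    have hh0 : h ≠ 0 := hh.ne'
    have hτ0 : τ ≠ 0 := hτ.ne'
    simp only [F, e1, e2, e3, e4, e5]
    generalize b / ((m : ℝ) + 2) = B at h0 ⊢
    have w0 : W i = 2 * P i - V i := by rw [hP]; ring
    have w1 : W (i + 1) = 2 * P (i + 1) - V (i + 1) := by rw [hP]; ring
    have w2 : W (i - 1) = 2 * P (i - 1) - V (i - 1) := by rw [hP]; ring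
    have w3 : W (i + 2) = 2 * P (i + 2) - V (i + 2) := by rw [hP]; ring
    have w4 : W (i - 2) = 2 * P (i - 2) - V (i - 2) := by rw [hP]; ring
    rw [w0, w1, w2, w3, w4] at h0
    rw [w0, w1, w2, w3, w4]
    generalize U (i + 1) ^ m = u1 at h0 ⊢
    generalize U (i - 1) ^ m = u2 at h0 ⊢
    generalize U i ^ m = u0 at h0 ⊢
    rw [← sub_eq_zero, ← mul_zero (4 * τ), ← h0]
    field_simp
    ring
  have hsum := Finset.sum_congr rfl key
  rw [hT] at hsum
  simp only [Finset.sum_sub_distrib, Finset.sum_add_distrib, ← Finset.mul_sum] at hsum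
  linear_combination h * hsum
end

section
/- (Uniqueness for the linear system at each time step.) Let m be a positive integer, a, b, c, ν real constants, α, λ > 0, and τ > 0, and let U ∈ Z_h^0 be a given mesh function. If W ∈ Z_h^0 satisfies, for all 2 ≤ i ≤ M−2, the homogeneous equation (1/(2τ)) W_i + (a/2)(W_{x̂})_i + (b/(2(m+2))) [ (U_i)^m (W_{x̂})_i + ((U^m W)_{x̂})_i ] + (c/2)(W_{x x̄ x̂})_i − (α/(2τ))(W_{x x̄})_i + (λ/(2τ))(W_{x x x̄ x̄})_i − (ν/2)(W_{x x x̄ x̄ x̂})_i = 0, where ((U^m W)_{x̂})_i = ((U_{i+1})^m W_{i+1} − (U_{i−1})^m W_{i−1})/(2h), then W_i = 0 for all i. Consequently, the three-level linearly implicit scheme determines each time level uniquely. -/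
/-- Uniqueness for the linear system at each time step of the three-level scheme:
if `W ∈ Z_h^0` satisfies the homogeneous equation, then `W = 0`. -/
theorem stmt_14 (M : ℤ) (hM : 4 ≤ M) (h : ℝ) (hh : 0 < h)
    (m : ℕ) (hm : 0 < m) (a b c ν α lam τ : ℝ) (hα : 0 < α) (hlam : 0 < lam) (hτ : 0 < τ)
    (U W : ℤ → ℝ)
    (hUz : ∀ i : ℤ, (i ≤ 1 ∨ M - 1 ≤ i) → U i = 0)
    (hW : ∀ i : ℤ, (i ≤ 1 ∨ M - 1 ≤ i) → W i = 0)
    (scheme : ∀ i : ℤ, 2 ≤ i → i ≤ M - 2 →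
      (1 / (2 * τ)) * W i
        + (a / 2) * ((W (i + 1) - W (i - 1)) / (2 * h))
        + (b / (2 * (m + 2))) * ((U i) ^ m * ((W (i + 1) - W (i - 1)) / (2 * h))
            + ((U (i + 1)) ^ m * W (i + 1) - (U (i - 1)) ^ m * W (i - 1)) / (2 * h))
        + (c / 2) * ((W (i + 2) - 2 * W (i + 1) + 2 * W (i - 1) - W (i - 2)) / (2 * h ^ 3))
        - (α / (2 * τ)) * ((W (i + 1) - 2 * W i + W (i - 1)) / h ^ 2)
        + (lam / (2 * τ)) * ((W (i + 2) - 4 * W (i + 1) + 6 * W i - 4 * W (i - 1) + W (i - 2))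
            / h ^ 4)
        - (ν / 2) * ((W (i + 3) - 4 * W (i + 2) + 5 * W (i + 1) - 5 * W (i - 1) + 4 * W (i - 2)
            - W (i - 3)) / (2 * h ^ 5))
        = 0) :
    ∀ i : ℤ, W i = 0 := by
  obtain ⟨V, hV⟩ : ∃ V : ℤ → ℝ, ∀ i, V i = U i ^ m := ⟨fun i => U i ^ m, fun _ => rfl⟩
  simp only [← hV] at scheme
  obtain ⟨B, hB⟩ : ∃ B : ℝ, B = b / (2 * (m + 2)) := ⟨_, rfl⟩
  rw [← hB] at scheme
  -- telescoping flux
  obtain ⟨G, hG⟩ : ∃ G : ℤ → ℝ, ∀ i, G i =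
      (a / 2) / (2 * h) * (W i * W (i - 1))
      + B / (2 * h) * ((V i + V (i - 1)) * (W i * W (i - 1)))
      + (c / 2) / (2 * h ^ 3) * ((W (i + 1) * W (i - 1) + W i * W (i - 2))
          - 2 * (W i * W (i - 1)))
      + (α / (2 * τ)) / h ^ 2 * (W (i - 1) ^ 2 - W i * W (i - 1))
      + (lam / (2 * τ)) / h ^ 4 * (W (i - 1) * (W (i + 1) - 2 * W i + W (i - 1))
          - W i * (W i - 2 * W (i - 1) + W (i - 2)))
      - (ν / 2) / (2 * h ^ 5) * ((W (i + 2) * W (i - 1) + W (i + 1) * W (i - 2) + W i * W (i - 3))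
          - 4 * (W (i + 1) * W (i - 1) + W i * W (i - 2)) + 5 * (W i * W (i - 1))) :=
    ⟨_, fun _ => rfl⟩
  have key : ∀ i : ℤ, G (i + 1) - G i = - ((1 / (2 * τ)) * W i ^ 2
      + (α / (2 * τ)) / h ^ 2 * (W i - W (i - 1)) ^ 2
      + (lam / (2 * τ)) / h ^ 4 * (W (i + 1) - 2 * W i + W (i - 1)) ^ 2) := by
    intro i
    have e : W i * ((1 / (2 * τ)) * W i
        + (a / 2) * ((W (i + 1) - W (i - 1)) / (2 * h))
        + B * (V i * ((W (i + 1) - W (i - 1)) / (2 * h))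
            + (V (i + 1) * W (i + 1) - V (i - 1) * W (i - 1)) / (2 * h))
        + (c / 2) * ((W (i + 2) - 2 * W (i + 1) + 2 * W (i - 1) - W (i - 2)) / (2 * h ^ 3))
        - (α / (2 * τ)) * ((W (i + 1) - 2 * W i + W (i - 1)) / h ^ 2)
        + (lam / (2 * τ)) * ((W (i + 2) - 4 * W (i + 1) + 6 * W i - 4 * W (i - 1) + W (i - 2))
            / h ^ 4)
        - (ν / 2) * ((W (i + 3) - 4 * W (i + 2) + 5 * W (i + 1) - 5 * W (i - 1) + 4 * W (i - 2)
            - W (i - 3)) / (2 * h ^ 5))) = 0 := by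
      by_cases hi : 2 ≤ i ∧ i ≤ M - 2
      · rw [scheme i hi.1 hi.2, mul_zero]
      · rw [hW i (by omega), zero_mul]
    rw [hG, hG]
    have e1 : i + 1 - 1 = i := by ring
    have e2 : i + 1 - 2 = i - 1 := by ring
    have e3 : i + 1 - 3 = i - 2 := by ring
    have e4 : i + 1 + 1 = i + 2 := by ring
    have e5 : i + 1 + 2 = i + 3 := by ring
    rw [e1, e2, e3, e4, e5]
    generalize W (i + 3) = w3 at *
    generalize W (i + 2) = w2 at *
    generalize W (i + 1) = w1 at *
    generalize W i = w0 at *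
    generalize W (i - 1) = v1 at *
    generalize W (i - 2) = v2 at *
    generalize W (i - 3) = v3 at *
    linear_combination e
  have anti : Antitone G := by
    apply antitone_int_of_succ_le
    intro i
    have := key i
    have : 0 ≤ (1 / (2 * τ)) * W i ^ 2
      + (α / (2 * τ)) / h ^ 2 * (W i - W (i - 1)) ^ 2
      + (lam / (2 * τ)) / h ^ 4 * (W (i + 1) - 2 * W i + W (i - 1)) ^ 2 := by positivity
    linarith
  have far : ∀ i : ℤ, (i ≤ -5 ∨ M + 5 ≤ i) → G i = 0 := by
    intro i hi
    rw [hG, hW i (by omega), hW (i - 1) (by omega), hW (i - 2) (by omega),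
      hW (i - 3) (by omega), hW (i + 1) (by omega)]
    ring
  have G0 : ∀ i, G i = 0 := by
    intro i
    apply le_antisymm
    · rw [← far (min i (-5)) (by omega)]
      exact anti (min_le_left _ _)
    · rw [← far (max i (M + 5)) (by omega)]
      exact anti (le_max_left _ _)
  intro i
  have k := key i
  rw [G0, G0] at k
  have p1 : 0 ≤ (α / (2 * τ)) / h ^ 2 * (W i - W (i - 1)) ^ 2 := by positivity
  have p2 : 0 ≤ (lam / (2 * τ)) / h ^ 4 * (W (i + 1) - 2 * W i + W (i - 1)) ^ 2 := by positivity
  have p3 : 0 < 1 / (2 * τ) := by positivity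
  by_contra hne
  have p4 : 0 < (1 / (2 * τ)) * W i ^ 2 := by positivity
  linarith
end

section
/- (Uniform bounds from the discrete energy.) Let α, λ > 0 and let E₀ ≥ 0. There exists a constant C > 0, depending only on α, λ, E₀ and the product L = M h, such that for every integer M ≥ 4, every h > 0 with M h = L, and every mesh function U ∈ Z_h^0 satisfying ‖U‖² + α‖U_x‖² + λ‖U_{x x̄}‖² ≤ E₀, one has both ‖U‖_∞ ≤ C and ‖U_x‖_∞ ≤ C, where ‖V‖_∞ = max_{1≤i≤M−1} |V_i|. -/
lemma aux_bound (M : ℤ) (h L : ℝ) (hh : 0 < h) (hL : (M : ℝ) * h = L) (V g : ℤ → ℝ)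
    (h0 : V 0 = 0) (hg : ∀ i : ℤ, V i - V (i - 1) = h * g i) (i : ℤ) (hi0 : 0 ≤ i)
    (hi : i ≤ M - 1) :
    (V i) ^ 2 ≤ L * (h * ∑ j ∈ Finset.Icc (1 : ℤ) (M - 1), (g j) ^ 2) := by
  obtain ⟨n, rfl⟩ := Int.eq_ofNat_of_zero_le hi0
  have tel : V (n : ℤ) = h * ∑ k ∈ Finset.range n, g ((k : ℤ) + 1) := by
    have := Finset.sum_range_sub (fun k : ℕ => V (k : ℤ)) n
    simp only [Nat.cast_zero, h0, sub_zero] at this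
    rw [← this, Finset.mul_sum]
    refine Finset.sum_congr rfl fun k _ => ?_
    rw [← hg]
    simp
  have cs := sq_sum_le_card_mul_sum_sq (s := Finset.range n) (f := fun k : ℕ => g ((k : ℤ) + 1))
  rw [Finset.card_range] at cs
  have sub : ∑ k ∈ Finset.range n, (g ((k : ℤ) + 1)) ^ 2
      ≤ ∑ j ∈ Finset.Icc (1 : ℤ) (M - 1), (g j) ^ 2 := by
    have e : ∑ j ∈ (Finset.range n).image (fun k : ℕ => (k : ℤ) + 1), (g j) ^ 2
        = ∑ k ∈ Finset.range n, (g ((k : ℤ) + 1)) ^ 2 := by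
      apply Finset.sum_image
      intro a _ b _ hab
      simpa using hab
    rw [← e]
    apply Finset.sum_le_sum_of_subset_of_nonneg
    · intro j hj
      simp only [Finset.mem_image, Finset.mem_range] at hj
      obtain ⟨k, hk, rfl⟩ := hj
      rw [Finset.mem_Icc]
      omega
    · intros
      positivity
  have hn : (n : ℝ) ≤ M := by
    have : (n : ℤ) ≤ M := by omega
    exact_mod_cast this
  set S := ∑ j ∈ Finset.Icc (1 : ℤ) (M - 1), (g j) ^ 2 with hS
  have hS0 : 0 ≤ S := Finset.sum_nonneg fun _ _ => sq_nonneg _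
  have step : (∑ k ∈ Finset.range n, g ((k : ℤ) + 1)) ^ 2 ≤ M * S :=
    cs.trans (mul_le_mul hn sub (Finset.sum_nonneg fun _ _ => sq_nonneg _)
      ((Nat.cast_nonneg n).trans hn))
  rw [tel, ← hL, mul_pow]
  calc h ^ 2 * _ ≤ h ^ 2 * (M * S) := mul_le_mul_of_nonneg_left step (sq_nonneg h)
    _ = _ := by ring

/-- Uniform bounds from the discrete energy: there is a constant `C > 0`, depending only on
`α, λ, E₀` and the length `L = M·h`, bounding `‖U‖_∞` and `‖U_x‖_∞` for every mesh function
`U ∈ Z_h^0` whose discrete energy is at most `E₀`. -/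
theorem stmt_16 (α lam E₀ L : ℝ) (hα : 0 < α) (hlam : 0 < lam) (hE : 0 ≤ E₀) :
    ∃ C : ℝ, 0 < C ∧
      ∀ (M : ℤ) (hM : 4 ≤ M) (h : ℝ) (hh : 0 < h) (hL : (M : ℝ) * h = L)
        (U : ℤ → ℝ) (hU : ∀ i : ℤ, (i ≤ 1 ∨ M - 1 ≤ i) → U i = 0),
          (h * ∑ i ∈ Finset.Icc (1 : ℤ) (M - 1), (U i) ^ 2)
            + α * (h * ∑ i ∈ Finset.Icc (1 : ℤ) (M - 1), ((U (i + 1) - U i) / h) ^ 2)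
            + lam * (h * ∑ i ∈ Finset.Icc (1 : ℤ) (M - 1),
                ((U (i + 1) - 2 * U i + U (i - 1)) / h ^ 2) ^ 2) ≤ E₀ →
          ((Finset.Icc (1 : ℤ) (M - 1)).sup' (Finset.nonempty_Icc.mpr (by omega))
              (fun i => |U i|) ≤ C
            ∧ (Finset.Icc (1 : ℤ) (M - 1)).sup' (Finset.nonempty_Icc.mpr (by omega))
              (fun i => |(U (i + 1) - U i) / h|) ≤ C) := by
  refine ⟨√(L * (E₀ / α)) + √(L * (E₀ / lam)) + 1, by positivity, ?_⟩
  intro M hM h hh hL U hU hen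
  have hMR : (4 : ℝ) ≤ M := by exact_mod_cast hM
  have hL0 : 0 ≤ L := by rw [← hL]; positivity
  have p1 : 0 ≤ h * ∑ i ∈ Finset.Icc (1 : ℤ) (M - 1), (U i) ^ 2 := by positivity
  have p2 : 0 ≤ h * ∑ i ∈ Finset.Icc (1 : ℤ) (M - 1), ((U (i + 1) - U i) / h) ^ 2 := by
    positivity
  have p3 : 0 ≤ h * ∑ i ∈ Finset.Icc (1 : ℤ) (M - 1),
      ((U (i + 1) - 2 * U i + U (i - 1)) / h ^ 2) ^ 2 := by positivity
  have q2 := mul_nonneg hα.le p2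
  have q3 := mul_nonneg hlam.le p3
  have b2 : h * ∑ i ∈ Finset.Icc (1 : ℤ) (M - 1), ((U (i + 1) - U i) / h) ^ 2 ≤ E₀ / α := by
    rw [le_div_iff₀ hα]; linarith
  have b3 : h * ∑ i ∈ Finset.Icc (1 : ℤ) (M - 1),
      ((U (i + 1) - 2 * U i + U (i - 1)) / h ^ 2) ^ 2 ≤ E₀ / lam := by
    rw [le_div_iff₀ hlam]; linarith
  have s2 := Real.sqrt_nonneg (L * (E₀ / α))
  have s3 := Real.sqrt_nonneg (L * (E₀ / lam))
  constructor
  · apply Finset.sup'_le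
    intro i hi
    rw [Finset.mem_Icc] at hi
    have := aux_bound M h L hh hL (fun i => U (i + 1)) (fun i => (U (i + 1) - U i) / h)
      (hU _ (by omega)) (fun i => by simp only [sub_add_cancel]; field_simp) (i - 1)
      (by omega) (by omega)
    simp only [sub_add_cancel] at this
    have := Real.abs_le_sqrt (this.trans (mul_le_mul_of_nonneg_left b2 hL0))
    linarith
  · apply Finset.sup'_le
    intro i hi
    rw [Finset.mem_Icc] at hi
    have := aux_bound M h L hh hL (fun i => (U (i + 1) - U i) / h)
      (fun i => (U (i + 1) - 2 * U i + U (i - 1)) / h ^ 2)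
      (by simp [hU 1 (by omega), hU 0 (by omega)])
      (fun i => by simp only [sub_add_cancel]; field_simp; ring) i
      (by omega) (by omega)
    have := Real.abs_le_sqrt (this.trans (mul_le_mul_of_nonneg_left b3 hL0))
    linarith
end

section
/- (Exact solitary solution, Example 1.) Set A = (3/4)(√370 − 5√10)/√(5√37 − 29), B = √(√37 − 5)/4, and v = (33 − 5√37)/(5√37 − 29). Then the function u(x,t) = A · sech²( B (x − v t) ) satisfies, for all (x,t) ∈ ℝ², the generalized Rosenau-Kawahara-RLW equation with m = 2, a = 1, b = 1, c = 2, α = 1, λ = 1, ν = 1, namely u_t + u_x + u² u_x + 2 u_{xxx} − u_{xxt} + u_{xxxxt} − u_{xxxxx} = 0. -/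
/-- The hyperbolic secant. -/
noncomputable def sech (y : ℝ) : ℝ := 2 / (Real.exp y + Real.exp (-y))

/-- The auxiliary function `tanh`, written with exponentials. -/
noncomputable def th (y : ℝ) : ℝ := (Real.exp y - Real.exp (-y)) / (Real.exp y + Real.exp (-y))

theorem sech_sq_eq (y : ℝ) : sech y ^ 2 = 1 - th y ^ 2 := by
  have h1 := Real.exp_pos y
  have h2 := Real.exp_pos (-y)
  have h3 : Real.exp y * Real.exp (-y) = 1 := by rw [← Real.exp_add]; simp
  have h4 : Real.exp y + Real.exp (-y) ≠ 0 := by positivity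
  unfold sech th
  field_simp
  linear_combination (-4) * h3

theorem hasDerivAt_th (y : ℝ) : HasDerivAt th (1 - th y ^ 2) y := by
  have h1 := Real.exp_pos y
  have h2 := Real.exp_pos (-y)
  have h4 : Real.exp y + Real.exp (-y) ≠ 0 := by positivity
  have e1 := Real.hasDerivAt_exp y
  have e2 : HasDerivAt (fun y : ℝ => Real.exp (-y)) (Real.exp (-y) * (-1)) y :=
    (hasDerivAt_neg y).exp
  have := (e1.sub e2).div (e1.add e2) h4
  refine this.congr_deriv ?_
  simp only [th, Pi.add_apply, Pi.sub_apply]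
  field_simp
  ring

/-- Chain rule for polynomial expressions in a solution of the Riccati equation. -/
theorem poly_step (w : ℝ → ℝ) (c C a0 a1 a2 a3 a4 a5 a6 : ℝ)
    (hw : ∀ y, HasDerivAt w (c * (1 - w y ^ 2)) y) (y : ℝ) :
    deriv (fun y => C * (a0 + a1 * w y + a2 * w y ^ 2 + a3 * w y ^ 3 + a4 * w y ^ 4
      + a5 * w y ^ 5 + a6 * w y ^ 6)) y
    = C * c * ((a1 + 2 * a2 * w y + 3 * a3 * w y ^ 2 + 4 * a4 * w y ^ 3
      + 5 * a5 * w y ^ 4 + 6 * a6 * w y ^ 5) * (1 - w y ^ 2)) := by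
  have h := hw y
  have := ((((((((h.const_mul a1).const_add a0).add ((h.pow 2).const_mul a2)).add
    ((h.pow 3).const_mul a3)).add ((h.pow 4).const_mul a4)).add
    ((h.pow 5).const_mul a5)).add ((h.pow 6).const_mul a6)).const_mul C)
  refine (this.congr_deriv ?_).deriv
  push_cast
  ring

theorem iter_derivs (w : ℝ → ℝ) (c A : ℝ)
    (hw : ∀ y, HasDerivAt w (c * (1 - w y ^ 2)) y) (f : ℝ → ℝ)
    (hf : ∀ y, f y = A * (1 - w y ^ 2)) :
    (∀ y, deriv f y = A * c * (-2 * w y + 2 * w y ^ 3)) ∧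
    (∀ y, iteratedDeriv 2 f y = A * c ^ 2 * (-2 + 8 * w y ^ 2 - 6 * w y ^ 4)) ∧
    (∀ y, iteratedDeriv 3 f y = A * c ^ 3 * (16 * w y - 40 * w y ^ 3 + 24 * w y ^ 5)) ∧
    (∀ y, iteratedDeriv 4 f y
      = A * c ^ 4 * (16 - 136 * w y ^ 2 + 240 * w y ^ 4 - 120 * w y ^ 6)) ∧
    (∀ y, iteratedDeriv 5 f y
      = A * c ^ 5 * (-272 * w y + 1232 * w y ^ 3 - 1680 * w y ^ 5 + 720 * w y ^ 7)) := by
  have d1 : ∀ y, deriv f y = A * c * (-2 * w y + 2 * w y ^ 3) := by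
    intro y
    have e : f = _ := funext fun y => (hf y).trans
      (show _ = A * (1 + 0 * w y + (-1) * w y ^ 2 + 0 * w y ^ 3 + 0 * w y ^ 4
        + 0 * w y ^ 5 + 0 * w y ^ 6) by ring)
    rw [e, poly_step w c _ _ _ _ _ _ _ _ hw]; ring
  have d2 : ∀ y, iteratedDeriv 2 f y = A * c ^ 2 * (-2 + 8 * w y ^ 2 - 6 * w y ^ 4) := by
    intro y
    have e : iteratedDeriv 1 f = _ := funext fun y => (congrFun iteratedDeriv_one y).trans
      ((d1 y).trans
      (show _ = (A * c) * (0 + (-2) * w y + 0 * w y ^ 2 + 2 * w y ^ 3 + 0 * w y ^ 4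
        + 0 * w y ^ 5 + 0 * w y ^ 6) by ring))
    rw [iteratedDeriv_succ, e, poly_step w c _ _ _ _ _ _ _ _ hw]; ring
  have d3 : ∀ y, iteratedDeriv 3 f y
      = A * c ^ 3 * (16 * w y - 40 * w y ^ 3 + 24 * w y ^ 5) := by
    intro y
    have e : iteratedDeriv 2 f = _ := funext fun y => (d2 y).trans
      (show _ = (A * c ^ 2) * (-2 + 0 * w y + 8 * w y ^ 2 + 0 * w y ^ 3 + (-6) * w y ^ 4
        + 0 * w y ^ 5 + 0 * w y ^ 6) by ring)
    rw [iteratedDeriv_succ, e, poly_step w c _ _ _ _ _ _ _ _ hw]; ring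
  have d4 : ∀ y, iteratedDeriv 4 f y
      = A * c ^ 4 * (16 - 136 * w y ^ 2 + 240 * w y ^ 4 - 120 * w y ^ 6) := by
    intro y
    have e : iteratedDeriv 3 f = _ := funext fun y => (d3 y).trans
      (show _ = (A * c ^ 3) * (0 + 16 * w y + 0 * w y ^ 2 + (-40) * w y ^ 3 + 0 * w y ^ 4
        + 24 * w y ^ 5 + 0 * w y ^ 6) by ring)
    rw [iteratedDeriv_succ, e, poly_step w c _ _ _ _ _ _ _ _ hw]; ring
  refine ⟨d1, d2, d3, d4, ?_⟩
  intro y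
  have e : iteratedDeriv 4 f = _ := funext fun y => (d4 y).trans
    (show _ = (A * c ^ 4) * (16 + 0 * w y + (-136) * w y ^ 2 + 0 * w y ^ 3 + 240 * w y ^ 4
      + 0 * w y ^ 5 + (-120) * w y ^ 6) by ring)
  rw [iteratedDeriv_succ, e, poly_step w c _ _ _ _ _ _ _ _ hw]; ring

/-- Exact solitary solution, Example 1: with
`A = (3/4)(√370 - 5√10)/√(5√37 - 29)`, `B = √(√37 - 5)/4`, `v = (33 - 5√37)/(5√37 - 29)`,
the function `u(x,t) = A sech²(B(x - vt))` satisfies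
`u_t + u_x + u² u_x + 2u_{xxx} - u_{xxt} + u_{xxxxt} - u_{xxxxx} = 0`. -/
theorem stmt_18 (A B v : ℝ)
    (hA : A = (3 / 4) * (Real.sqrt 370 - 5 * Real.sqrt 10)
              / Real.sqrt (5 * Real.sqrt 37 - 29))
    (hB : B = Real.sqrt (Real.sqrt 37 - 5) / 4)
    (hv : v = (33 - 5 * Real.sqrt 37) / (5 * Real.sqrt 37 - 29))
    (u : ℝ → ℝ → ℝ)
    (hu : ∀ x t : ℝ, u x t = A * (sech (B * (x - v * t))) ^ 2) :
    ∀ x t : ℝ,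
      deriv (fun s => u x s) t
        + deriv (fun y => u y t) x
        + (u x t) ^ 2 * deriv (fun y => u y t) x
        + 2 * iteratedDeriv 3 (fun y => u y t) x
        - deriv (fun s => iteratedDeriv 2 (fun y => u y s) x) t
        + deriv (fun s => iteratedDeriv 4 (fun y => u y s) x) t
        - iteratedDeriv 5 (fun y => u y t) x
      = 0 := by
  intro x t
  -- algebra of the constants
  obtain ⟨r, hr⟩ : ∃ r, r = Real.sqrt 37 := ⟨_, rfl⟩
  have hr2 : r ^ 2 = 37 := by rw [hr]; exact Real.sq_sqrt (by norm_num)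
  have hr0 : 0 ≤ r := by rw [hr]; exact Real.sqrt_nonneg _
  have hr6 : 6 < r := by nlinarith
  have h370 : Real.sqrt 370 = r * Real.sqrt 10 := by
    rw [hr, ← Real.sqrt_mul (by norm_num)]; norm_num
  have h10 : Real.sqrt 10 ^ 2 = 10 := Real.sq_sqrt (by norm_num)
  rw [← hr] at hB hv hA
  rw [h370] at hA
  have hd : 0 < 5 * r - 29 := by linarith
  have hB2 : B ^ 2 = (r - 5) / 16 := by
    rw [hB, div_pow, Real.sq_sqrt (by linarith)]; norm_num
  have hA2 : A ^ 2 = 9 / 16 * ((r - 5) ^ 2 * 10) / (5 * r - 29) := by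
    rw [hA, div_pow, Real.sq_sqrt hd.le]
    congr 1
    linear_combination 9 / 16 * (r - 5) ^ 2 * h10
  have hv1 : v * (5 * r - 29) = 33 - 5 * r := by rw [hv]; field_simp
  have hA3 : A ^ 2 * (5 * r - 29) = 45 / 8 * (r - 5) ^ 2 := by
    rw [hA2, div_mul_cancel₀ _ hd.ne']; ring
  have hB4 : B ^ 4 = ((r - 5) / 16) ^ 2 := by rw [← hB2]; ring
  have c1 : (1 - v) + 4 * B ^ 2 * (2 + v) - 16 * B ^ 4 * (v + 1) = 0 := by
    rw [hB4, hB2]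
    apply mul_right_cancel₀ hd.ne'
    linear_combination (-1 + 4 * ((r - 5) / 16) - 16 * ((r - 5) / 16) ^ 2) * hv1 + hr2
  have c2 : 20 * B ^ 2 * (v + 1) = 2 + v := by
    rw [hB2]
    apply mul_right_cancel₀ hd.ne'
    linear_combination (20 * ((r - 5) / 16) - 1) * hv1
  have c3 : A ^ 2 = 360 * B ^ 4 * (v + 1) := by
    rw [hB4]
    apply mul_right_cancel₀ hd.ne'
    linear_combination hA3 - 360 * ((r - 5) / 16) ^ 2 * hv1
  -- derivatives
  have hx : ∀ s y, HasDerivAt (fun y => th (B * (y - v * s)))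
      (B * (1 - th (B * (y - v * s)) ^ 2)) y := by
    intro s y
    have h := (((hasDerivAt_id y).sub_const (v * s)).const_mul B)
    have := (hasDerivAt_th (B * (y - v * s))).comp y h
    exact this.congr_deriv (by ring)
  have ht : ∀ s, HasDerivAt (fun s => th (B * (x - v * s)))
      ((-(B * v)) * (1 - th (B * (x - v * s)) ^ 2)) s := by
    intro s
    have h := ((((hasDerivAt_id s).const_mul v).const_sub x).const_mul B)
    have := (hasDerivAt_th (B * (x - v * s))).comp s h
    exact this.congr_deriv (by ring)
  have hu' : ∀ s y, u y s = A * (1 - th (B * (y - v * s)) ^ 2) := fun s y => by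
    rw [hu, sech_sq_eq]
  have X := fun s => iter_derivs _ B A (hx s) (fun y => u y s) (hu' s)
  obtain ⟨x1, x2, x3, x4, x5⟩ := X t
  have t1 := (iter_derivs _ _ A ht (fun s => u x s) (fun s => hu' s x)).1 t
  have t2 : deriv (fun s => iteratedDeriv 2 (fun y => u y s) x) t
      = A * B ^ 2 * (-(B * v)) * ((16 * th (B * (x - v * t)) - 24 * th (B * (x - v * t)) ^ 3)
        * (1 - th (B * (x - v * t)) ^ 2)) := by
    have e : (fun s => iteratedDeriv 2 (fun y => u y s) x) = _ :=
      funext fun s => ((X s).2.1 x).trans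
      (show _ = (A * B ^ 2) * (-2 + 0 * th (B * (x - v * s)) + 8 * th (B * (x - v * s)) ^ 2
        + 0 * th (B * (x - v * s)) ^ 3 + (-6) * th (B * (x - v * s)) ^ 4
        + 0 * th (B * (x - v * s)) ^ 5 + 0 * th (B * (x - v * s)) ^ 6) by ring)
    rw [e, poly_step (fun s => th (B * (x - v * s))) _ _ _ _ _ _ _ _ _ ht]; ring
  have t4 : deriv (fun s => iteratedDeriv 4 (fun y => u y s) x) t
      = A * B ^ 4 * (-(B * v)) * ((-272 * th (B * (x - v * t)) + 960 * th (B * (x - v * t)) ^ 3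
        - 720 * th (B * (x - v * t)) ^ 5) * (1 - th (B * (x - v * t)) ^ 2)) := by
    have e : (fun s => iteratedDeriv 4 (fun y => u y s) x) = _ :=
      funext fun s => ((X s).2.2.2.1 x).trans
      (show _ = (A * B ^ 4) * (16 + 0 * th (B * (x - v * s))
        + (-136) * th (B * (x - v * s)) ^ 2
        + 0 * th (B * (x - v * s)) ^ 3 + 240 * th (B * (x - v * s)) ^ 4
        + 0 * th (B * (x - v * s)) ^ 5 + (-120) * th (B * (x - v * s)) ^ 6) by ring)
    rw [e, poly_step (fun s => th (B * (x - v * s))) _ _ _ _ _ _ _ _ _ ht]; ring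
  rw [t1, t2, t4, x1, x3, x5, hu']
  generalize th (B * (x - v * t)) = g
  linear_combination A * B * (-2 * g * (1 - g ^ 2)) * (c1 + 12 * (1 - g ^ 2) * B ^ 2 * c2
    + (1 - g ^ 2) ^ 2 * c3)
end

section
/- (Exact solitary solution, Example 2.) Set A = ( 40 (√127 − 10)² / (3 (10√127 − 109)) )^{1/4}, B = √(√127 − 10)/3, and v = (118 − 10√127)/(10√127 − 109). Then the function u(x,t) = A · sech( B (x − v t) ) satisfies, for all (x,t) ∈ ℝ², the generalized Rosenau-Kawahara-RLW equation with m = 4, a = 1, b = 1, c = 2, α = 1, λ = 1, ν = 1, namely u_t + u_x + u⁴ u_x + 2 u_{xxx} − u_{xxt} + u_{xxxxt} − u_{xxxxx} = 0. -/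
noncomputable def thh (y : ℝ) : ℝ :=
  (Real.exp y - Real.exp (-y)) / (Real.exp y + Real.exp (-y))

lemma den_pos (y : ℝ) : 0 < Real.exp y + Real.exp (-y) := by positivity

lemma sech_thh_sq (y : ℝ) : thh y ^ 2 = 1 - sech y ^ 2 := by
  have h := (den_pos y).ne'
  have h2 : Real.exp y * Real.exp (-y) = 1 := by rw [← Real.exp_add]; simp
  unfold thh sech
  field_simp
  linear_combination (-4) * h2

lemma hasDerivAt_sech (y : ℝ) : HasDerivAt sech (-(sech y * thh y)) y := by
  have h := (den_pos y).ne'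
  have he : HasDerivAt (fun z : ℝ => Real.exp (-z)) (Real.exp (-y) * (-1)) y :=
    (hasDerivAt_neg y).exp
  have h1 := (hasDerivAt_const y (2 : ℝ)).div ((Real.hasDerivAt_exp y).add he) h
  refine HasDerivAt.congr_deriv (f := sech) h1 ?_
  simp only [Pi.add_apply]
  unfold thh sech
  field_simp
  ring

lemma d0 (y : ℝ) : HasDerivAt sech (-(sech y * thh y)) y := hasDerivAt_sech y

lemma hasDerivAt_thh (y : ℝ) : HasDerivAt thh (sech y ^ 2) y := by
  have h := (den_pos y).ne'
  have h2 : Real.exp y * Real.exp (-y) = 1 := by rw [← Real.exp_add]; simp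
  have he : HasDerivAt (fun z : ℝ => Real.exp (-z)) (Real.exp (-y) * (-1)) y :=
    (hasDerivAt_neg y).exp
  have h1 := ((Real.hasDerivAt_exp y).sub he).div ((Real.hasDerivAt_exp y).add he) h
  refine HasDerivAt.congr_deriv (f := thh) h1 ?_
  simp only [Pi.add_apply, Pi.sub_apply]
  unfold sech
  field_simp
  linear_combination 4 * h2

lemma d1 (y : ℝ) : HasDerivAt (fun y => -(sech y * thh y)) (sech y - 2 * sech y ^ 3) y := by
  refine HasDerivAt.congr_deriv ((hasDerivAt_sech y).mul (hasDerivAt_thh y)).neg ?_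
  linear_combination sech y * sech_thh_sq y

lemma d2 (y : ℝ) : HasDerivAt (fun y => sech y - 2 * sech y ^ 3)
    (-(sech y * thh y) * (1 - 6 * sech y ^ 2)) y := by
  refine HasDerivAt.congr_deriv
    ((hasDerivAt_sech y).sub (((hasDerivAt_sech y).pow 3).const_mul 2)) ?_
  push_cast
  ring

lemma d3 (y : ℝ) : HasDerivAt (fun y => -(sech y * thh y) * (1 - 6 * sech y ^ 2))
    (sech y - 20 * sech y ^ 3 + 24 * sech y ^ 5) y := by
  refine HasDerivAt.congr_deriv
    ((d1 y).mul ((((hasDerivAt_sech y).pow 2).const_mul 6).const_sub 1)) ?_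
  push_cast
  linear_combination (-12 * sech y ^ 3) * sech_thh_sq y

lemma d4 (y : ℝ) : HasDerivAt (fun y => sech y - 20 * sech y ^ 3 + 24 * sech y ^ 5)
    (-(sech y * thh y) * (1 - 60 * sech y ^ 2 + 120 * sech y ^ 4)) y := by
  refine HasDerivAt.congr_deriv
    (((hasDerivAt_sech y).sub (((hasDerivAt_sech y).pow 3).const_mul 20)).add
      (((hasDerivAt_sech y).pow 5).const_mul 24)) ?_
  push_cast
  ring

lemma dx {f g : ℝ → ℝ} (h : ∀ y, HasDerivAt f (g y) y) (c B s : ℝ) :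
    deriv (fun y => c * f (B * (y - s))) = fun y => c * B * g (B * (y - s)) := by
  funext y
  have h1 : HasDerivAt (fun y => B * (y - s)) B y := by
    simpa using ((hasDerivAt_id y).sub_const s).const_mul B
  have h2 := ((h (B * (y - s))).comp y h1).const_mul c
  refine (h2.deriv).trans ?_
  ring

lemma dt {f g : ℝ → ℝ} (h : ∀ y, HasDerivAt f (g y) y) (c B v x t : ℝ) :
    deriv (fun s => c * f (B * (x - v * s))) t = -(c * B * v) * g (B * (x - v * t)) := by
  have h1 : HasDerivAt (fun s => B * (x - v * s)) (-(B * v)) t := by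
    simpa using (((hasDerivAt_id t).const_mul v).const_sub x).const_mul B
  have h2 := ((h (B * (x - v * t))).comp t h1).const_mul c
  refine (h2.deriv).trans ?_
  ring

/-- Exact solitary solution, Example 2: with
`A = (40(√127 - 10)²/(3(10√127 - 109)))^{1/4}`, `B = √(√127 - 10)/3`,
`v = (118 - 10√127)/(10√127 - 109)`, the function `u(x,t) = A sech(B(x - vt))` satisfies
`u_t + u_x + u⁴ u_x + 2u_{xxx} - u_{xxt} + u_{xxxxt} - u_{xxxxx} = 0`. -/
theorem stmt_19 (A B v : ℝ)
    (hA : A = (40 * (Real.sqrt 127 - 10) ^ 2 / (3 * (10 * Real.sqrt 127 - 109)))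
              ^ ((1 : ℝ) / 4))
    (hB : B = Real.sqrt (Real.sqrt 127 - 10) / 3)
    (hv : v = (118 - 10 * Real.sqrt 127) / (10 * Real.sqrt 127 - 109))
    (u : ℝ → ℝ → ℝ)
    (hu : ∀ x t : ℝ, u x t = A * sech (B * (x - v * t))) :
    ∀ x t : ℝ,
      deriv (fun s => u x s) t
        + deriv (fun y => u y t) x
        + (u x t) ^ 4 * deriv (fun y => u y t) x
        + 2 * iteratedDeriv 3 (fun y => u y t) x
        - deriv (fun s => iteratedDeriv 2 (fun y => u y s) x) t
        + deriv (fun s => iteratedDeriv 4 (fun y => u y s) x) t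
        - iteratedDeriv 5 (fun y => u y t) x
      = 0 := by
  intro x t
  have hr : Real.sqrt 127 ^ 2 = 127 := Real.sq_sqrt (by norm_num)
  have hr0 : 0 ≤ Real.sqrt 127 := Real.sqrt_nonneg _
  have hr1 : 11 < Real.sqrt 127 := by nlinarith
  have hB2 : B ^ 2 = (Real.sqrt 127 - 10) / 9 := by
    rw [hB, div_pow, Real.sq_sqrt (by linarith)]; norm_num
  have hD : 0 < 10 * Real.sqrt 127 - 109 := by linarith
  have hA4 : A ^ 4 = 40 * (Real.sqrt 127 - 10) ^ 2 / (3 * (10 * Real.sqrt 127 - 109)) := by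
    rw [hA, ← Real.rpow_natCast, ← Real.rpow_mul (by positivity)]
    norm_num
  clear hA hB
  generalize Real.sqrt 127 = r at *
  have hD0 : 10 * r - 109 ≠ 0 := hD.ne'
  have e0 : 1 + v = 9 / (10 * r - 109) := by
    rw [hv]; field_simp; ring
  have e1 : 2 + v = 10 * (1 + v) * B ^ 2 := by
    rw [hB2, hv]; field_simp; ring
  have e2 : A ^ 4 = 120 * (1 + v) * (B ^ 2) ^ 2 := by
    rw [e0, hB2, hA4]; field_simp; ring
  have e3 : 1 - v + (2 + v) * B ^ 2 - (1 + v) * (B ^ 2) ^ 2 = 0 := by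
    rw [hB2, hv]; field_simp; linear_combination 81 * hr
  simp only [hu]
  simp only [iteratedDeriv_succ, iteratedDeriv_zero, dx d0, dx d1, dx d2, dx d3, dx d4]
  rw [dt d0, dt d2, dt d4]
  generalize sech (B * (x - v * t)) = S
  generalize thh (B * (x - v * t)) = T
  linear_combination (-(A * B * S * T)) * e3 + (6 * A * B ^ 3 * S ^ 3 * T) * e1
    - (A * B * S ^ 5 * T) * e2
end
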